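/- There exists a finitely presented group G with a finite generating set Y such that (G,Y) is almost convex and G is non-Hopfian (hence not residually finite). -/

import Mathlib

/-!  Common framework: words over an inverse-closed generating set, word length,
geodesics, falsification by fellow traveler property, almost convexity. -/

namespace ACPaper

section Core

variable {β G : Type*} [Group G]

/-- A letter is a generator (`Sum.inl`) or the formal inverse of a generator (`Sum.inr`);
this realizes the inverse-closed alphabet `X^{±1}`. -/
def letterEval (gen : β → G) : β ⊕ β → G :=
  Sum.elim gen fun b => (gen b)⁻¹

/-- Evaluation of a word over `X^{±1}` in the group. -/
def eval (gen : β → G) (w : List (β ⊕ β)) : G :=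
  (w.map (letterEval gen)).prod

/-- `gen` is a generating set: every element is represented by some word. -/
def Generates (gen : β → G) : Prop :=
  ∀ g : G, ∃ w : List (β ⊕ β), eval gen w = g

/-- Word length of a group element with respect to the generating set. -/
noncomputable def wlen (gen : β → G) (g : G) : ℕ :=
  sInf {n : ℕ | ∃ w : List (β ⊕ β), eval gen w = g ∧ w.length = n}

/-- A word is geodesic if its length equals the word length of the element it represents. -/
def IsGeodesic (gen : β → G) (w : List (β ⊕ β)) : Prop :=
  w.length = wlen gen (eval gen w)

/-- The point reached after `t` steps along the unit-speed path labelled by `w`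
(the path remains at its endpoint after time `w.length`). -/
def pos (gen : β → G) (w : List (β ⊕ β)) (t : ℕ) : G :=
  eval gen (w.take t)

/-- Synchronous falsification by fellow traveler property with constant `k`:
every non-geodesic word is synchronously `k`-fellow traveled by a shorter word
representing the same element. -/
def SynchFFTP (gen : β → G) (k : ℕ) : Prop :=
  ∀ w : List (β ⊕ β), ¬ IsGeodesic gen w →
    ∃ w' : List (β ⊕ β), eval gen w' = eval gen w ∧ w'.length < w.length ∧
      ∀ t : ℕ, wlen gen ((pos gen w t)⁻¹ * pos gen w' t) ≤ k

/-- The path starting at `g` labelled by the word `w` stays in the ball of radius `N`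
about the identity. -/
def PathInBall (gen : β → G) (N : ℕ) (g : G) (w : List (β ⊕ β)) : Prop :=
  ∀ t : ℕ, wlen gen (g * pos gen w t) ≤ N

/-- Almost convexity with constant `C`: any two elements of the sphere of radius `N ≥ 1`
at distance at most `2` are joined by a path of length at most `C` inside the ball of
radius `N`. -/
def AlmostConvexWith (gen : β → G) (C : ℕ) : Prop :=
  ∀ N : ℕ, 1 ≤ N → ∀ g g' : G, wlen gen g = N → wlen gen g' = N →
    wlen gen (g⁻¹ * g') ≤ 2 →
    ∃ w : List (β ⊕ β), g * eval gen w = g' ∧ w.length ≤ C ∧ PathInBall gen N g w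

/-- Almost convexity: almost convex with some positive constant. -/
def AlmostConvex (gen : β → G) : Prop :=
  ∃ C : ℕ, 0 < C ∧ AlmostConvexWith gen C

end Core

section Words

variable {β G : Type*} [Group G] (gen : β → G)

@[simp]
lemma eval_nil : eval gen [] = 1 := rfl

@[simp]
lemma eval_cons (x : β ⊕ β) (w : List (β ⊕ β)) :
    eval gen (x :: w) = letterEval gen x * eval gen w := by
  simp [eval]

@[simp]
lemma eval_append (u v : List (β ⊕ β)) : eval gen (u ++ v) = eval gen u * eval gen v := by
  simp [eval]

@[simp]
lemma eval_replicate (n : ℕ) (x : β ⊕ β) :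
    eval gen (List.replicate n x) = letterEval gen x ^ n := by
  simp [eval]

@[simp]
lemma letterEval_swap (x : β ⊕ β) : letterEval gen x.swap = (letterEval gen x)⁻¹ := by
  cases x <;> simp [letterEval]

/-- The formal inverse of a word. -/
def wordInv (w : List (β ⊕ β)) : List (β ⊕ β) := (w.map Sum.swap).reverse

@[simp]
lemma length_wordInv (w : List (β ⊕ β)) : (wordInv w).length = w.length := by
  simp [wordInv]

@[simp]
lemma wordInv_nil : wordInv ([] : List (β ⊕ β)) = [] := rfl

@[simp]
lemma wordInv_cons (x : β ⊕ β) (w : List (β ⊕ β)) :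
    wordInv (x :: w) = wordInv w ++ [x.swap] := by
  simp [wordInv]

@[simp]
lemma wordInv_append (u v : List (β ⊕ β)) : wordInv (u ++ v) = wordInv v ++ wordInv u := by
  simp [wordInv]

@[simp]
lemma wordInv_wordInv (w : List (β ⊕ β)) : wordInv (wordInv w) = w := by
  simp [wordInv, Function.comp_def]

@[simp]
lemma eval_wordInv (w : List (β ⊕ β)) : eval gen (wordInv w) = (eval gen w)⁻¹ := by
  induction w with
  | nil => simp
  | cons x w ih => simp [ih]

lemma wlen_eval_le (w : List (β ⊕ β)) : wlen gen (eval gen w) ≤ w.length :=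
  Nat.sInf_le ⟨w, rfl, rfl⟩

lemma wlen_letterEval_le (x : β ⊕ β) : wlen gen (letterEval gen x) ≤ 1 := by
  simpa using wlen_eval_le gen [x]

variable {gen}

lemma exists_eval_eq_length_eq (hg : Generates gen) (g : G) :
    ∃ w, eval gen w = g ∧ w.length = wlen gen g :=
  Nat.sInf_mem (s := {n | ∃ w, eval gen w = g ∧ w.length = n}) <|
    let ⟨w, hw⟩ := hg g
    ⟨w.length, w, hw, rfl⟩

lemma wlen_mul_le (hg : Generates gen) (g h : G) :
    wlen gen (g * h) ≤ wlen gen g + wlen gen h := by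
  obtain ⟨u, rfl, hu⟩ := exists_eval_eq_length_eq hg g
  obtain ⟨v, rfl, hv⟩ := exists_eval_eq_length_eq hg h
  rw [← hu, ← hv, ← List.length_append, ← eval_append]
  exact wlen_eval_le gen _

lemma wlen_inv_le (hg : Generates gen) (g : G) : wlen gen g⁻¹ ≤ wlen gen g := by
  obtain ⟨u, rfl, hu⟩ := exists_eval_eq_length_eq hg g
  rw [← hu, ← length_wordInv, ← eval_wordInv]
  exact wlen_eval_le gen _

lemma IsGeodesic.wordInv (hg : Generates gen) {w : List (β ⊕ β)} (hw : IsGeodesic gen w) :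
    IsGeodesic gen (wordInv w) := by
  refine le_antisymm ?_ (wlen_eval_le gen _)
  rw [length_wordInv, hw, eval_wordInv]
  simpa using wlen_inv_le hg (eval gen w)⁻¹

lemma IsGeodesic.length_le {w : List (β ⊕ β)} (hw : IsGeodesic gen w) {u : List (β ⊕ β)}
    (h : eval gen u = eval gen w) : w.length ≤ u.length := by
  rw [hw, ← h]
  exact wlen_eval_le gen u

lemma IsGeodesic.of_append_right {u v : List (β ⊕ β)} (h : IsGeodesic gen (u ++ v))
    {v' : List (β ⊕ β)} (hv : eval gen v' = eval gen v) : v.length ≤ v'.length := by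
  have := h.length_le (u := u ++ v') (by simp [hv])
  simpa using this

variable (gen) in
/-- `g` and `g'` are joined by a path of length at most `n` inside the ball of radius `N`. -/
def Joined (N n : ℕ) (g g' : G) : Prop :=
  ∃ w : List (β ⊕ β), g * eval gen w = g' ∧ w.length ≤ n ∧ PathInBall gen N g w

lemma Joined.refl {N : ℕ} {g : G} (h : wlen gen g ≤ N) : Joined gen N 0 g g :=
  ⟨[], by simp, by simp, fun t => by simpa [pos] using h⟩

lemma Joined.mono {N m n : ℕ} {g g' : G} (h : Joined gen N m g g') (hmn : m ≤ n) :
    Joined gen N n g g' :=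
  let ⟨w, h1, h2, h3⟩ := h
  ⟨w, h1, h2.trans hmn, h3⟩

lemma Joined.trans {N m n : ℕ} {g g' g'' : G} (h : Joined gen N m g g')
    (h' : Joined gen N n g' g'') : Joined gen N (m + n) g g'' := by
  obtain ⟨u, rfl, hu, hu'⟩ := h
  obtain ⟨v, rfl, hv, hv'⟩ := h'
  refine ⟨u ++ v, by simp [mul_assoc], by simp; omega, fun t => ?_⟩
  rw [pos, List.take_append, eval_append]
  rcases le_total t u.length with ht | ht
  · simpa [Nat.sub_eq_zero_of_le ht, pos] using hu' t
  · simpa [List.take_of_length_le ht, pos, mul_assoc] using hv' (t - u.length)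

lemma Joined.symm {N n : ℕ} {g g' : G} (h : Joined gen N n g g') : Joined gen N n g' g := by
  obtain ⟨w, rfl, hw, hw'⟩ := h
  refine ⟨wordInv w, by simp, by simpa using hw, fun t => ?_⟩
  have e : eval gen w = eval gen (w.take (w.length - t)) * eval gen (w.drop (w.length - t)) := by
    rw [← eval_append, List.take_append_drop]
  have e' : pos gen (wordInv w) t = (eval gen (w.drop (w.length - t)))⁻¹ := by
    rw [pos, wordInv, List.take_reverse, ← eval_wordInv, wordInv, List.length_map, List.map_drop]
  have := hw' (w.length - t)
  rw [e', e]
  simpa [mul_assoc, pos] using this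

lemma Joined.step {N : ℕ} {g g' : G} (x : β ⊕ β) (h : wlen gen g ≤ N) (h' : wlen gen g' ≤ N)
    (hx : g * letterEval gen x = g') : Joined gen N 1 g g' := by
  subst hx
  refine ⟨[x], by simp, by simp, fun t => ?_⟩
  cases t <;> simpa [pos]

/-- A path whose length is small compared to the norms of its endpoints stays in the ball. -/
lemma Joined.of_wlen_add_le (hg : Generates gen) {N : ℕ} {g g' : G} (w : List (β ⊕ β))
    (hw : g * eval gen w = g') (h : wlen gen g + wlen gen g' + w.length ≤ 2 * N + 1) :
    Joined gen N w.length g g' := by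
  subst hw
  refine ⟨w, rfl, le_rfl, fun t => ?_⟩
  have h1 : wlen gen (g * pos gen w t) ≤ wlen gen g + (w.take t).length :=
    (wlen_mul_le hg _ _).trans (Nat.add_le_add_left (wlen_eval_le gen _) _)
  have h2 : wlen gen (g * pos gen w t) ≤ wlen gen (g * eval gen w) + (w.drop t).length := by
    have : g * pos gen w t = (g * eval gen w) * eval gen (wordInv (w.drop t)) := by
      have e : eval gen w = eval gen (w.take t) * eval gen (w.drop t) := by
        rw [← eval_append, List.take_append_drop]
      simp [e, pos, mul_assoc]
    rw [this]
    refine (wlen_mul_le hg _ _).trans (Nat.add_le_add_left ?_ _)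
    simpa using wlen_eval_le gen (wordInv (w.drop t))
  simp only [List.length_take, List.length_drop] at h1 h2
  omega

/-- To prove almost convexity it suffices to join the predecessors of each element. -/
lemma almostConvex_of_joined (hg : Generates gen) {C : ℕ}
    (hC : ∀ (N : ℕ) (h : G) (x y : β ⊕ β), wlen gen h = N + 1 →
      wlen gen (h * (letterEval gen x)⁻¹) = N → wlen gen (h * (letterEval gen y)⁻¹) = N →
      Joined gen N C (h * (letterEval gen x)⁻¹) (h * (letterEval gen y)⁻¹)) :
    AlmostConvex gen := by
  refine ⟨C + 2, by omega, fun N _ g g' h h' hgg => ?_⟩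
  change Joined gen N (C + 2) g g'
  obtain ⟨w, hw, hlen⟩ := exists_eval_eq_length_eq hg (g⁻¹ * g')
  obtain rfl : g' = g * eval gen w := by simp [hw]
  rw [← hlen] at hgg
  match w, hgg with
  | [], _ => simpa using (Joined.refl h.le).mono (by omega)
  | [x], _ => exact (Joined.step x h.le h'.le (by simp)).mono (by omega)
  | [x, y], _ =>
    have hm : wlen gen (g * letterEval gen x) ≤ N + 1 :=
      (wlen_mul_le hg _ _).trans (by have := wlen_letterEval_le gen x; omega)
    rcases hm.lt_or_eq with hm | hm
    · exact ((Joined.step x h.le (by omega) rfl).trans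
        (Joined.step y (by omega) h'.le (by simp [mul_assoc]))).mono (by omega)
    · have := hC N _ x y.swap hm (by simpa using h) (by simpa [mul_assoc] using h')
      simpa [mul_assoc, pos] using this.mono (show C ≤ C + 2 by omega)

end Words

section Dickson

/-- **Dickson's lemma**: a property of multisets over a finite type that holds for some multiset
holds for a submultiset of bounded size. -/
lemma exists_card_bound {Λ : Type*} [Finite Λ] (P : Multiset Λ → Prop) :
    ∃ C : ℕ, ∀ u, P u → ∃ v ≤ u, P v ∧ v.card ≤ C := by
  classical
  have : WellQuasiOrderedLE (Multiset Λ) := ⟨fun f => by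
    obtain ⟨i, j, hij, h⟩ := wellQuasiOrdered_le (α := Λ → ℕ) fun n a => (f n).count a
    exact ⟨i, j, hij, Multiset.le_iff_count.2 h⟩⟩
  have hfin : {v | Minimal P v}.Finite :=
    WellQuasiOrderedLE.finite_of_isAntichain (setOfPred_minimal_antichain P)
  obtain ⟨C, hC⟩ := (hfin.image Multiset.card).bddAbove
  refine ⟨C, fun u hu => ?_⟩
  obtain ⟨v, hvu, hv⟩ := exists_minimal_le_of_wellFoundedLT P u hu
  exact ⟨v, hvu, hv.prop, hC ⟨v, hv, rfl⟩⟩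

variable {B A : Type*} [CommGroup A] (gA : B → A)

lemma eval_perm {u v : List (B ⊕ B)} (h : u.Perm v) : eval gA u = eval gA v :=
  (h.map _).prod_eq

lemma multiset_prod_map_letterEval (u : Multiset (B ⊕ B)) :
    (u.map (letterEval gA)).prod = eval gA u.toList := by
  conv_lhs => rw [← Multiset.coe_toList u]
  rfl

/-- In an abelian group, a shortcut for the path labelled `e x y⁻¹ f⁻¹` can be found after deleting
all but a bounded number of letters of `e` and `f`. -/
lemma exists_bounded_shortcut [Finite B] :
    ∃ C : ℕ, ∀ (e f v : List (B ⊕ B)) (x y : B ⊕ B),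
      eval gA v = eval gA (e ++ [x]) * (eval gA (f ++ [y]))⁻¹ →
      v.length < e.length + f.length + 2 →
      ∃ r e₁ r' f₁ v₁ : List (B ⊕ B), e.Perm (r ++ e₁) ∧ f.Perm (r' ++ f₁) ∧
        e₁.length + f₁.length ≤ C ∧ v₁.length < e₁.length + f₁.length + 2 ∧
        eval gA v₁ = eval gA (e₁ ++ [x]) * (eval gA (f₁ ++ [y]))⁻¹ := by
  classical
  obtain ⟨C, hC⟩ := exists_card_bound fun u : Multiset (B ⊕ B) =>
    ∃ v : List (B ⊕ B), v.length < u.card ∧ eval gA v = (u.map (letterEval gA)).prod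
  refine ⟨C, fun e f v x y hv hlen => ?_⟩
  have hswap : ∀ m : Multiset (B ⊕ B), ((m.map Sum.swap).map (letterEval gA)).prod =
      ((m.map (letterEval gA)).prod)⁻¹ := by
    intro m
    simp [Multiset.map_map]
  obtain ⟨m, hm, ⟨v', hv'len, hv'⟩, hcard⟩ := hC
    ((x ::ₘ (e : Multiset (B ⊕ B))) + (y ::ₘ (f : Multiset (B ⊕ B))).map Sum.swap)
    ⟨v, by simp; omega, by
      rw [hv, Multiset.map_add, Multiset.prod_add, hswap]
      simp [eval, mul_comm]⟩
  set m₁ := m ∩ (x ::ₘ (e : Multiset (B ⊕ B))) with hm₁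
  set m₂ := m - (x ::ₘ (e : Multiset (B ⊕ B))) with hm₂
  have hsum : m₁ + m₂ = m := by
    ext a
    simp only [hm₁, hm₂, Multiset.count_add, Multiset.count_inter, Multiset.count_sub]
    omega
  have h₁ : m₁.erase x ≤ e := Multiset.erase_le_iff_le_cons.2 Multiset.inter_le_right
  have h₂ : (m₂.map Sum.swap).erase y ≤ f := by
    refine Multiset.erase_le_iff_le_cons.2 ?_
    have : m₂ ≤ (y ::ₘ (f : Multiset (B ⊕ B))).map Sum.swap := by
      rw [hm₂, tsub_le_iff_left]
      exact hm
    simpa [Multiset.map_map, Function.comp_def] using Multiset.map_le_map (f := Sum.swap) this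
  set E := m₁.erase x with hE
  set F := (m₂.map Sum.swap).erase y with hF
  have hEle : E.card ≤ m₁.card := Multiset.card_le_card (Multiset.erase_le _ _)
  have hFle : F.card ≤ m₂.card := by
    simpa using Multiset.card_le_card (Multiset.erase_le y (m₂.map Sum.swap))
  have hcardm : m₁.card + m₂.card = m.card := by rw [← hsum, Multiset.card_add]
  have hle : m ≤ (x ::ₘ E) + (y ::ₘ F).map Sum.swap := by
    rw [← hsum]
    refine add_le_add (Multiset.le_cons_erase _ _) ?_
    have := Multiset.map_le_map (f := Sum.swap) (Multiset.le_cons_erase (m₂.map Sum.swap) y)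
    simpa [Multiset.map_map, Function.comp_def] using this
  obtain ⟨d, hd⟩ := Multiset.le_iff_exists_add.1 hle
  have hdcard := congrArg Multiset.card hd
  simp only [Multiset.card_add, Multiset.card_cons, Multiset.card_map] at hdcard
  refine ⟨((e : Multiset (B ⊕ B)) - E).toList, E.toList, ((f : Multiset (B ⊕ B)) - F).toList,
    F.toList, v' ++ d.toList, ?_, ?_, ?_, ?_, ?_⟩
  · rw [← Multiset.coe_eq_coe, ← Multiset.coe_add, Multiset.coe_toList, Multiset.coe_toList,
      tsub_add_cancel_of_le h₁]
  · rw [← Multiset.coe_eq_coe, ← Multiset.coe_add, Multiset.coe_toList, Multiset.coe_toList,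
      tsub_add_cancel_of_le h₂]
  · simp only [Multiset.length_toList]
    omega
  · simp only [List.length_append, Multiset.length_toList]
    omega
  · have := congrArg (fun m => (m.map (letterEval gA)).prod) hd
    simp only [Multiset.map_add, Multiset.prod_add, hswap] at this
    rw [eval_append, hv', ← multiset_prod_map_letterEval, ← this]
    simp [multiset_prod_map_letterEval, mul_comm]

end Dickson

section Strips

variable {B S G A : Type*} [Group G] [CommGroup A]

/-- The inclusion of base letters into all letters. -/
def baseLetter : B ⊕ B → (B ⊕ S) ⊕ (B ⊕ S) := Sum.map Sum.inl Sum.inl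

/-- The inclusion of words in the base letters into all words. -/
def baseWord (w : List (B ⊕ B)) : List ((B ⊕ S) ⊕ (B ⊕ S)) := w.map baseLetter

@[simp]
lemma swap_baseLetter (x : B ⊕ B) :
    (baseLetter x : (B ⊕ S) ⊕ (B ⊕ S)).swap = baseLetter x.swap := by
  cases x <;> rfl

@[simp]
lemma baseWord_nil : (baseWord [] : List ((B ⊕ S) ⊕ (B ⊕ S))) = [] := rfl

@[simp]
lemma baseWord_cons (x : B ⊕ B) (w : List (B ⊕ B)) :
    (baseWord (x :: w) : List ((B ⊕ S) ⊕ (B ⊕ S))) = baseLetter x :: baseWord w := rfl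

@[simp]
lemma baseWord_append (u v : List (B ⊕ B)) :
    (baseWord (u ++ v) : List ((B ⊕ S) ⊕ (B ⊕ S))) = baseWord u ++ baseWord v := by
  simp [baseWord]

@[simp]
lemma length_baseWord (u : List (B ⊕ B)) :
    (baseWord u : List ((B ⊕ S) ⊕ (B ⊕ S))).length = u.length := by
  simp [baseWord]

@[simp]
lemma baseWord_replicate (n : ℕ) (x : B ⊕ B) :
    (baseWord (List.replicate n x) : List ((B ⊕ S) ⊕ (B ⊕ S))) =
      List.replicate n (baseLetter x) := by
  simp [baseWord]

@[simp]
lemma wordInv_baseWord (u : List (B ⊕ B)) :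
    wordInv (baseWord u : List ((B ⊕ S) ⊕ (B ⊕ S))) = baseWord (wordInv u) := by
  induction u with
  | nil => rfl
  | cons x u ih => simp [ih]

lemma baseWord_eq_append {V : List (B ⊕ B)} {u v : List ((B ⊕ S) ⊕ (B ⊕ S))}
    (h : baseWord V = u ++ v) :
    ∃ V₁ V₂, V = V₁ ++ V₂ ∧ baseWord V₁ = u ∧ baseWord V₂ = v := by
  obtain ⟨V₁, V₂, h1, h2, h3⟩ := List.map_eq_append_iff.1 h
  exact ⟨V₁, V₂, h1, h2, h3⟩

/-- A word has a pinch if it contains a subword `σ V σ⁻¹` where `V` is a word in the base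
letters that represents a power of an edge generator at `σ`. -/
def HasPinch (gA : B → A) (strip : (B ⊕ S) ⊕ (B ⊕ S) → B ⊕ B → B ⊕ B → Prop)
    (w : List ((B ⊕ S) ⊕ (B ⊕ S))) : Prop :=
  ∃ p σ V q y z, ∃ k : ℕ, w = p ++ σ :: baseWord V ++ σ.swap :: q ∧ strip σ y z ∧
    eval gA V = letterEval gA y ^ k

/-- The properties of an isometric multiple HNN extension `G` of an abelian group `A` which are
used to prove almost convexity. The relation `strip σ y z` says that `σ y = z σ` bounds a square of
the Cayley graph. -/
structure IsIsometricHNN (gen : B ⊕ S → G) (gA : B → A)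
    (strip : (B ⊕ S) ⊕ (B ⊕ S) → B ⊕ B → B ⊕ B → Prop) : Prop where
  generates : Generates gen
  eval_eq_iff : ∀ u v : List (B ⊕ B),
    eval gen (baseWord u) = eval gen (baseWord v) ↔ eval gA u = eval gA v
  strip_swap : ∀ σ y z, strip σ y z → strip σ y.swap z.swap
  letterEval_mul : ∀ σ y z, strip σ y z →
    letterEval gen σ * letterEval gen (baseLetter y) =
      letterEval gen (baseLetter z) * letterEval gen σ
  britton : ∀ w u, eval gen w = eval gen (baseWord u) →
    (∃ v, w = baseWord v) ∨ HasPinch gA strip w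
  extremal : ∀ y : B ⊕ B, ∃ l : A →* Multiplicative ℤ,
    ∀ x, x ≠ y → l (letterEval gA x) < l (letterEval gA y)

end Strips

section Main

variable {B S G A : Type*} [Group G] [CommGroup A] {gen : B ⊕ S → G} {gA : B → A}
  {strip : (B ⊕ S) ⊕ (B ⊕ S) → B ⊕ B → B ⊕ B → Prop}

lemma length_of_eval_eq_pow {y : B ⊕ B}
    (hy : ∃ l : A →* Multiplicative ℤ, ∀ x, x ≠ y → l (letterEval gA x) < l (letterEval gA y))
    {V : List (B ⊕ B)} {k : ℕ} (hV : eval gA V = letterEval gA y ^ k) :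
    k ≤ V.length ∧ (V.length ≤ k → V = List.replicate V.length y) := by
  obtain ⟨l, hl⟩ := hy
  set M : ℤ := (l (letterEval gA y)).toAdd with hM
  have hl' : ∀ x, x ≠ y → (l (letterEval gA x)).toAdd < M := hl
  have hle : ∀ x, (l (letterEval gA x)).toAdd ≤ M := fun x => by
    by_cases h : x = y
    · rw [h]
    · exact (hl' x h).le
  have hpos : 0 < M := by
    have := hl' y.swap (by cases y <;> simp)
    rw [letterEval_swap, map_inv, toAdd_inv, ← hM] at this
    omega
  have hsum : ∀ W : List (B ⊕ B), (l (eval gA W)).toAdd ≤ W.length * M := by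
    intro W
    induction W with
    | nil => simp
    | cons x W ih =>
      have := hle x
      simp only [eval_cons, map_mul, toAdd_mul, List.length_cons]
      push_cast
      linarith
  have hk : (l (eval gA V)).toAdd = k * M := by
    rw [hV, map_pow, toAdd_pow, nsmul_eq_mul]
  refine ⟨?_, fun hlen => List.eq_replicate_of_mem fun x hx => ?_⟩
  · have := hsum V
    rw [hk] at this
    exact_mod_cast le_of_mul_le_mul_right this hpos
  · by_contra hxy
    obtain ⟨V₁, V₂, rfl⟩ := List.append_of_mem hx
    have h1 := hsum V₁
    have h2 := hsum V₂
    have h3 := hl' x hxy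
    have h4 : ((V₁ ++ x :: V₂).length : ℤ) * M ≤ k * M :=
      mul_le_mul_of_nonneg_right (by exact_mod_cast hlen) hpos.le
    rw [← hk] at h4
    simp only [eval_append, eval_cons, map_mul, toAdd_mul, List.length_append,
      List.length_cons] at h4
    push_cast at h4
    linarith

namespace IsIsometricHNN

variable (H : IsIsometricHNN gen gA strip)
include H

lemma letterEval_mul_pow {σ : (B ⊕ S) ⊕ (B ⊕ S)} {y z : B ⊕ B} (h : strip σ y z) (k : ℕ) :
    letterEval gen σ * letterEval gen (baseLetter y) ^ k =
      letterEval gen (baseLetter z) ^ k * letterEval gen σ := by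
  have h : SemiconjBy (letterEval gen σ) (letterEval gen (baseLetter y))
    (letterEval gen (baseLetter z)) := H.letterEval_mul _ _ _ h
  exact h.pow_right k

lemma eval_baseWord_eq_pow {V : List (B ⊕ B)} {y : B ⊕ B} {k : ℕ}
    (hV : eval gA V = letterEval gA y ^ k) :
    eval gen (baseWord V) = letterEval gen (baseLetter y) ^ k := by
  simpa using (H.eval_eq_iff V (List.replicate k y)).2 (by simpa using hV)

lemma not_hasPinch {w : List ((B ⊕ S) ⊕ (B ⊕ S))} (hw : IsGeodesic gen w) :
    ¬ HasPinch gA strip w := by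
  rintro ⟨p, σ, V, q, y, z, k, rfl, hs, hV⟩
  have h1 := (length_of_eval_eq_pow (H.extremal y) hV).1
  have h2 := hw.length_le (u := p ++ (List.replicate k (baseLetter z) ++ q)) (by
    have := H.letterEval_mul_pow hs k
    simp only [eval_append, eval_cons, eval_replicate, letterEval_swap,
      H.eval_baseWord_eq_pow hV]
    rw [this]
    group)
  simp at h2
  omega

/-- Two geodesics with the same endpoint cross the same last strip. -/
lemma geodesic_pair {W U : List ((B ⊕ S) ⊕ (B ⊕ S))} (hW : IsGeodesic gen W)
    (hU : IsGeodesic gen U) (hWU : eval gen W = eval gen U) :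
    (∃ e f, W = baseWord e ∧ U = baseWord f ∧ eval gA e = eval gA f) ∨
    ∃ p q σ e f y z, ∃ k : ℕ, W = p ++ σ :: baseWord e ∧ U = q ++ σ :: baseWord f ∧
      strip σ y z ∧ eval gA e * (eval gA f)⁻¹ = letterEval gA y ^ k := by
  have hU' := H.not_hasPinch (hU.wordInv H.generates)
  rcases H.britton (W ++ wordInv U) [] (by simp [hWU]) with ⟨v, hv⟩ | hp
  · left
    obtain ⟨e, f, -, rfl, hf⟩ := baseWord_eq_append hv.symm
    have hf : U = baseWord (wordInv f) := by
      rw [← wordInv_baseWord, hf, wordInv_wordInv]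
    subst hf
    exact ⟨e, wordInv f, rfl, rfl, (H.eval_eq_iff _ _).1 hWU⟩
  · right
    obtain ⟨p, σ, V, q, y, z, k, h, hs, hV⟩ := hp
    rcases List.append_eq_append_iff.1 h.symm with ⟨c, hc, hc'⟩ | ⟨c, hc, hc'⟩
    · cases c with
      | nil =>
        refine ⟨p, wordInv q, σ, V, [], y, z, k, by simpa using hc, ?_, hs, by simpa using hV⟩
        rw [← wordInv_wordInv U, ← List.nil_append (wordInv U), ← hc']
        simp
      | cons x c =>
        simp only [List.cons_append, List.cons.injEq] at hc'
        exact absurd ⟨p, σ, V, c, y, z, k, by rw [hc, hc'.1], hs, hV⟩ (H.not_hasPinch hW)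
    · rcases List.append_eq_append_iff.1 hc with ⟨d, hd, hd'⟩ | ⟨d, hd, hd'⟩
      · cases d with
        | nil =>
          refine absurd ⟨[], σ, V, q, y, z, k, ?_, hs, hV⟩ hU'
          rw [hc', ← List.nil_append c, ← hd']
          simp
        | cons x d =>
          simp only [List.cons_append, List.cons.injEq] at hd'
          obtain ⟨e, f, rfl, rfl, rfl⟩ := baseWord_eq_append hd'.2
          refine ⟨p, wordInv q, σ, e, wordInv f, y, z, k, by rw [hd, hd'.1], ?_, hs,
            by simpa using hV⟩
          rw [← wordInv_wordInv U, hc']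
          simp
      · exact absurd ⟨d, σ, V, q, y, z, k, by rw [hc', hd'], hs, hV⟩ hU'

lemma eval_baseWord_perm {u v : List (B ⊕ B)} (h : u.Perm v) :
    eval gen (baseWord u) = eval gen (baseWord v) :=
  (H.eval_eq_iff u v).2 (eval_perm gA h)

/-- Removing letters at the end of a geodesic inside a flat. -/
lemma wlen_and_joined {N : ℕ} {h : G} {P : List ((B ⊕ S) ⊕ (B ⊕ S))} {e r e₁ : List (B ⊕ B)}
    {x : B ⊕ B} (hP : eval gen (P ++ baseWord (e ++ [x])) = h)
    (hlen : P.length + e.length = N) (he : e.Perm (r ++ e₁)) :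
    wlen gen (eval gen (P ++ baseWord r)) + e₁.length ≤ N ∧
    h = eval gen (P ++ baseWord r) * eval gen (baseWord (e₁ ++ [x])) ∧
    eval gen (P ++ baseWord r) * eval gen (baseWord e₁) =
      h * (letterEval gen (baseLetter x))⁻¹ := by
  have h1 := H.eval_baseWord_perm he
  have h2 := he.length_eq
  have h3 := wlen_eval_le gen (P ++ baseWord r)
  subst hP
  simp only [List.length_append, length_baseWord] at h2 h3
  refine ⟨by omega, ?_, ?_⟩
  · simp only [baseWord_append] at h1
    simp [h1, mul_assoc]
  · simp only [baseWord_append] at h1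
    simp [h1, mul_assoc]

lemma joined_of_shortcut [Finite B] :
    ∃ C : ℕ, ∀ (N : ℕ) (h : G) (P Q : List ((B ⊕ S) ⊕ (B ⊕ S))) (e f v : List (B ⊕ B))
      (x y : B ⊕ B), eval gen (P ++ baseWord (e ++ [x])) = h →
      eval gen (Q ++ baseWord (f ++ [y])) = h →
      wlen gen (h * (letterEval gen (baseLetter x))⁻¹) = N →
      wlen gen (h * (letterEval gen (baseLetter y))⁻¹) = N →
      P.length + e.length = N → Q.length + f.length = N →
      eval gA v = eval gA (e ++ [x]) * (eval gA (f ++ [y]))⁻¹ →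
      v.length < e.length + f.length + 2 →
      Joined gen N C (h * (letterEval gen (baseLetter x))⁻¹)
        (h * (letterEval gen (baseLetter y))⁻¹) := by
  obtain ⟨C, hC⟩ := exists_bounded_shortcut gA
  refine ⟨2 * C + 1, fun N h P Q e f v x y hP hQ hx hy hPe hQf hv hlen => ?_⟩
  obtain ⟨r, e₁, r', f₁, v₁, he, hf, hC₁, hlen₁, hv₁⟩ := hC e f v x y hv hlen
  obtain ⟨hp₁, hp₂, hp₃⟩ := H.wlen_and_joined hP hPe he
  obtain ⟨hq₁, hq₂, hq₃⟩ := H.wlen_and_joined hQ hQf hf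
  set p := eval gen (P ++ baseWord r)
  set q := eval gen (Q ++ baseWord r')
  have J₁ : Joined gen N e₁.length (h * (letterEval gen (baseLetter x))⁻¹) p := by
    have := Joined.of_wlen_add_le H.generates (N := N) (g := h * (letterEval gen (baseLetter x))⁻¹)
      (g' := p) (baseWord (wordInv e₁)) (by
        rw [← hp₃, ← wordInv_baseWord, eval_wordInv, mul_inv_cancel_right])
      (by simp; omega)
    simpa using this
  have J₂ : Joined gen N v₁.length p q := by
    have := Joined.of_wlen_add_le H.generates (N := N) (g := p) (g' := q) (baseWord v₁) ?_
      (by simp; omega)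
    · simpa using this
    · have := (H.eval_eq_iff (v₁ ++ (f₁ ++ [y])) (e₁ ++ [x])).2 (by
        rw [eval_append, hv₁, inv_mul_cancel_right])
      rw [baseWord_append, eval_append] at this
      rw [eq_comm, ← mul_left_inj (eval gen (baseWord (f₁ ++ [y]))), mul_assoc, this, ← hp₂, ← hq₂]
  have J₃ : Joined gen N f₁.length q (h * (letterEval gen (baseLetter y))⁻¹) := by
    have := Joined.of_wlen_add_le H.generates (N := N) (g := q)
      (g' := h * (letterEval gen (baseLetter y))⁻¹) (baseWord f₁) hq₃
      (by simp; omega)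
    simpa using this
  exact ((J₁.trans J₂).trans J₃).mono (by omega)

/-- The predecessors of `h` across a strip and along the strip are joined by crossing the strip
one step earlier. -/
lemma joined_of_cross {N : ℕ} {h : G} {Q : List ((B ⊕ S) ⊕ (B ⊕ S))}
    {σ : (B ⊕ S) ⊕ (B ⊕ S)} {y z x : B ⊕ B} {f : List (B ⊕ B)} {k : ℕ} (hs : strip σ y z)
    (hU : IsGeodesic gen (Q ++ σ :: baseWord (f ++ [x])))
    (hQ : eval gen (Q ++ σ :: baseWord (f ++ [x])) = h) (hlen : Q.length + 1 + f.length = N)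
    (hk : eval gA (f ++ [x]) = letterEval gA y ^ k)
    (h₁ : wlen gen (h * (letterEval gen σ)⁻¹) = N)
    (h₂ : wlen gen (h * (letterEval gen (baseLetter x))⁻¹) = N) :
    Joined gen N 2 (h * (letterEval gen σ)⁻¹) (h * (letterEval gen (baseLetter x))⁻¹) := by
  have hle : (f ++ [x]).length ≤ k := by
    have hU' : IsGeodesic gen ((Q ++ [σ]) ++ baseWord (f ++ [x])) := by simpa using hU
    have := hU'.of_append_right (v' := List.replicate k (baseLetter y)) (by
      rw [H.eval_baseWord_eq_pow hk]; simp)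
    simpa using this
  obtain ⟨hge, hrep⟩ := length_of_eval_eq_pow (H.extremal y) hk
  have hrep := hrep hle
  rw [List.length_append, List.length_singleton, List.replicate_succ',
    List.append_singleton_inj] at hrep
  obtain ⟨hf, rfl⟩ := hrep
  generalize f.length = n at hlen hf
  subst hf
  have e2 := H.letterEval_mul_pow hs (n + 1)
  have hh : h = eval gen Q * letterEval gen (baseLetter z) ^ (n + 1) * letterEval gen σ := by
    rw [← hQ]
    simp only [eval_append, eval_cons, ← List.replicate_succ', baseWord_replicate, eval_replicate]
    rw [e2]
    group
  have hmid : wlen gen (eval gen (Q ++ List.replicate n (baseLetter z))) ≤ N :=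
    (wlen_eval_le gen _).trans (by simp; omega)
  refine (Joined.step (baseLetter z).swap h₁.le hmid ?_).trans (Joined.step σ hmid h₂.le ?_)
  · rw [hh, letterEval_swap]
    simp only [eval_append, eval_replicate, pow_succ]
    group
  · have e3 := H.letterEval_mul _ _ _ hs
    rw [hh, eq_mul_inv_iff_mul_eq, mul_assoc, e3]
    simp only [eval_append, eval_replicate, pow_succ]
    group

/-- Two predecessors of `h` in opposite directions along a strip are joined through the
strip. -/
lemma joined_of_opposite {N : ℕ} {h : G} {P Q : List ((B ⊕ S) ⊕ (B ⊕ S))}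
    {σ : (B ⊕ S) ⊕ (B ⊕ S)} {y z : B ⊕ B} {m n : ℕ} (hs : strip σ y z)
    (hP : eval gen P * letterEval gen σ * letterEval gen (baseLetter y) ^ (m + 1) = h)
    (hQ : eval gen Q * letterEval gen σ = h * letterEval gen (baseLetter y) ^ (n + 1))
    (hPN : P.length + 1 + m = N) (hQN : Q.length + 1 + n = N)
    (h₁ : wlen gen (h * (letterEval gen (baseLetter y))⁻¹) = N)
    (h₂ : wlen gen (h * letterEval gen (baseLetter y)) = N) :
    Joined gen N 4 (h * (letterEval gen (baseLetter y))⁻¹)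
      (h * letterEval gen (baseLetter y)) := by
  set z' := letterEval gen (baseLetter z) with hz'
  set y' := letterEval gen (baseLetter y) with hy'
  set s := letterEval gen σ with hsdef
  have e0 : s * y' = z' * s := H.letterEval_mul _ _ _ hs
  have e1 := H.letterEval_mul_pow hs (m + 1)
  have e2 := H.letterEval_mul_pow hs (n + 1)
  rw [← hz', ← hy', ← hsdef] at e1 e2
  have e3 : s⁻¹ * z' = y' * s⁻¹ := by
    rw [inv_mul_eq_iff_eq_mul, ← mul_assoc, e0]; simp
  have hP' : eval gen P * z' ^ (m + 1) * s = h := by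
    rw [← hP, mul_assoc, ← e1, mul_assoc]
  have hQ' : eval gen Q = h * s⁻¹ * z' ^ (n + 1) := by
    have : s⁻¹ * z' ^ (n + 1) = y' ^ (n + 1) * s⁻¹ := by
      rw [inv_mul_eq_iff_eq_mul, ← mul_assoc, e2]; simp
    rw [mul_assoc, this, ← mul_assoc, ← hQ]; simp
  have w1 : wlen gen (eval gen (P ++ List.replicate m (baseLetter z))) ≤ N :=
    (wlen_eval_le gen _).trans (by simp; omega)
  have w2 : wlen gen (eval gen (P ++ List.replicate (m + 1) (baseLetter z))) ≤ N :=
    (wlen_eval_le gen _).trans (by simp; omega)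
  have w3 : wlen gen (eval gen (Q ++ List.replicate n (baseLetter z).swap)) ≤ N :=
    (wlen_eval_le gen _).trans (by simp; omega)
  refine (((Joined.step σ.swap h₁.le w1 ?_).trans (Joined.step (baseLetter z) w1 w2 ?_)).trans
    (Joined.step (baseLetter z) w2 w3 ?_)).trans (Joined.step σ w3 h₂.le ?_)
  · have : y'⁻¹ * s⁻¹ = s⁻¹ * z'⁻¹ := by
      rw [← mul_inv_rev, ← mul_inv_rev, e0]
    rw [letterEval_swap, ← hsdef, mul_assoc, this, ← hP']
    simp only [eval_append, eval_replicate, ← hz', pow_succ]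
    group
  · simp only [eval_append, eval_replicate, ← hz', pow_succ]
    group
  · simp only [eval_append, eval_replicate, letterEval_swap, ← hz', hQ']
    rw [← hP']
    simp only [pow_succ]
    group
  · simp only [eval_append, eval_replicate, letterEval_swap, ← hz', hQ', ← hsdef]
    rw [show h * s⁻¹ * z' ^ (n + 1) * z'⁻¹ ^ n * s = h * (s⁻¹ * z') * s by
      simp only [pow_succ]; group, e3]
    group

/-- A multiple HNN extension of an abelian group with isometric edge groups is almost convex. -/
theorem almostConvex [Finite B] : AlmostConvex gen := by
  obtain ⟨C, hC⟩ := H.joined_of_shortcut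
  refine almostConvex_of_joined H.generates (C := C + 4) fun N h x y hh hx hy => ?_
  obtain ⟨W, hW, hWlen⟩ := exists_eval_eq_length_eq H.generates (h * (letterEval gen x)⁻¹)
  obtain ⟨U, hU, hUlen⟩ := exists_eval_eq_length_eq H.generates (h * (letterEval gen y)⁻¹)
  rw [hx] at hWlen
  rw [hy] at hUlen
  have hWx : eval gen (W ++ [x]) = h := by simp [hW]
  have hUy : eval gen (U ++ [y]) = h := by simp [hU]
  have gW : IsGeodesic gen (W ++ [x]) := by rw [IsGeodesic, hWx, hh]; simp [hWlen]
  have gU : IsGeodesic gen (U ++ [y]) := by rw [IsGeodesic, hUy, hh]; simp [hUlen]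
  rcases H.geodesic_pair gW gU (hWx.trans hUy.symm) with
    ⟨e, f, he, hf, hef⟩ | ⟨p, q, σ, e, f, a, b, k, he, hf, hs, hk⟩
  · rcases List.eq_nil_or_concat' e with rfl | ⟨e, x, rfl⟩
    · simp at he
    rcases List.eq_nil_or_concat' f with rfl | ⟨f, y, rfl⟩
    · simp at hf
    simp only [baseWord_append, baseWord_cons, baseWord_nil, List.append_singleton_inj] at he hf
    obtain ⟨rfl, rfl⟩ := he
    obtain ⟨rfl, rfl⟩ := hf
    exact (hC N h [] [] e f [] x y (by simpa using hWx) (by simpa using hUy) hx hy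
      (by simpa using hWlen) (by simpa using hUlen) (by simp [hef]) (by simp)).mono (by omega)
  · rcases List.eq_nil_or_concat' e with rfl | ⟨e, x, rfl⟩ <;>
      rcases List.eq_nil_or_concat' f with rfl | ⟨f, y, rfl⟩ <;>
      simp only [baseWord_append, baseWord_cons, baseWord_nil, List.append_singleton_inj,
        ← List.cons_append, ← List.append_assoc] at he hf <;>
      obtain ⟨rfl, rfl⟩ := he <;> obtain ⟨rfl, rfl⟩ := hf
    · exact (Joined.refl hx.le).mono (by omega)
    · refine (H.joined_of_cross (f := f) (Q := q) (k := k) (H.strip_swap _ _ _ hs)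
        (by simpa using gU) (by simpa using hUy) (by simp at hUlen; omega) ?_ hx hy).mono (by omega)
      rw [letterEval_swap, inv_pow, ← hk]
      simp
    · refine (H.joined_of_cross (f := e) (Q := p) (k := k) hs
        (by simpa using gW) (by simpa using hWx) (by simp at hWlen; omega) ?_ hy hx).symm.mono
        (by omega)
      rw [← hk]
      simp
    · have hk' : eval gA ((e ++ [x]) ++ wordInv (f ++ [y])) = letterEval gA a ^ k := by
        rw [eval_append, eval_wordInv, hk]
      obtain ⟨hle, hrep⟩ := length_of_eval_eq_pow (H.extremal a) hk'
      rcases hle.lt_or_eq with hlt | heq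
      · exact (hC N h (p ++ [σ]) (q ++ [σ]) e f (List.replicate k a) x y (by simpa using hWx)
          (by simpa using hUy) hx hy (by simp at hWlen ⊢; omega) (by simp at hUlen ⊢; omega)
          (by rw [hk]; simp) (by simp at hlt ⊢; omega)).mono (by omega)
      · obtain ⟨-, he, hf⟩ := List.append_eq_replicate_iff.1 (hrep heq.ge)
        rw [List.length_append, List.length_singleton, List.replicate_succ',
          List.append_singleton_inj] at he
        rw [wordInv_append, wordInv_cons, wordInv_nil, List.nil_append, List.singleton_append,
          List.length_cons, List.replicate_succ, List.cons.injEq] at hf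
        obtain ⟨he, rfl⟩ := he
        obtain ⟨rfl, hf⟩ := hf
        rw [length_wordInv] at hf
        have hf' : eval gen (baseWord f) =
            (letterEval gen (baseLetter y.swap) ^ f.length)⁻¹ := by
          rw [← wordInv_wordInv f, ← wordInv_baseWord, eval_wordInv, hf]
          simp
        refine (?_ : Joined gen N 4 _ _).mono (by omega)
        have J := H.joined_of_opposite (N := N) (h := h) (P := p) (Q := q) (m := e.length)
          (n := f.length) hs ?_ ?_ ?_ ?_ hx ?_
        · rwa [← swap_baseLetter, letterEval_swap] at J ⊢
        · rw [he] at hWx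
          simpa [pow_succ, mul_assoc] using hWx
        · rw [eval_append, eval_cons, hf', ← mul_assoc, mul_inv_eq_iff_eq_mul] at hU
          rw [hU, pow_succ', ← swap_baseLetter, letterEval_swap, mul_assoc]
        · simp at hWlen; omega
        · simp at hUlen; omega
        · rwa [← swap_baseLetter, letterEval_swap]

end IsIsometricHNN
end Main

section Britton

open HNNExtension

variable {G : Type*} [Group G] {A B : Subgroup G} (φ : A ≃* B)

/-- The value of a letter, which is either an element of the base group or a stable letter. -/
def hnnLetter : G ⊕ ℤˣ → HNNExtension G A B φ :=
  Sum.elim of fun u => t ^ (u : ℤ)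

lemma prod_map_hnnLetter_inl (L : List G) :
    ((L.map Sum.inl).map (hnnLetter φ)).prod = of L.prod := by
  rw [map_list_prod]
  simp [hnnLetter, Function.comp_def]

/-- A word either contains a pinch or is represented by a reduced word. -/
lemma pinch_or_reduced (W : List (G ⊕ ℤˣ)) :
    (∃ (p : List (G ⊕ ℤˣ)) (u : ℤˣ) (L : List G) (q : List (G ⊕ ℤˣ)), W = p ++ Sum.inr u :: (L.map Sum.inl ++ Sum.inr (-u) :: q) ∧
      L.prod ∈ toSubgroup A B u) ∨
    ∃ (R : NormalWord.ReducedWord G A B) (L : List G) (T : List (G ⊕ ℤˣ)),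
      R.prod φ = (W.map (hnnLetter φ)).prod ∧ W = L.map Sum.inl ++ T ∧ L.prod = R.head ∧
      ((R.toList = [] ∧ T = []) ∨ ∃ u g T' l, R.toList = (u, g) :: l ∧ T = Sum.inr u :: T') := by
  induction W with
  | nil => exact .inr ⟨.empty G A B, [], [], by simp [NormalWord.ReducedWord.prod], rfl, rfl,
      .inl ⟨rfl, rfl⟩⟩
  | cons x W ih =>
    rcases ih with ⟨p, u, L, q, rfl, hL⟩ | ⟨R, L, T, hR, rfl, hL, hT⟩
    · exact .inl ⟨x :: p, u, L, q, rfl, hL⟩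
    · cases x with
      | inl g =>
        refine .inr ⟨⟨g * R.head, R.toList, R.chain⟩, g :: L, T, ?_, rfl, by simp [hL], hT⟩
        rw [List.map_cons, List.prod_cons, ← hR]
        simp [NormalWord.ReducedWord.prod, hnnLetter, mul_assoc]
      | inr u =>
        by_cases hc : R.toList.head? = none ∨
          ∃ y ∈ R.toList.head?, R.head ∈ toSubgroup A B u → u = y.1
        · refine .inr ⟨⟨1, (u, R.head) :: R.toList, ?_⟩, [], _, ?_, rfl, rfl,
            .inr ⟨u, _, _, _, rfl, rfl⟩⟩
          · refine List.isChain_cons.2 ⟨fun y hy => ?_, R.chain⟩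
            rcases hc with hc | ⟨z, hz, hc⟩
            · simp [hc] at hy
            · cases Option.mem_unique hz hy
              exact hc
          · rw [List.map_cons, List.prod_cons, ← hR]
            simp [NormalWord.ReducedWord.prod, hnnLetter, mul_assoc]
        · left
          rcases hT with ⟨h, -⟩ | ⟨v, g, T', l, h, rfl⟩
          · simp [h] at hc
          · simp only [h, List.head?_cons, reduceCtorEq, Option.mem_some_iff, exists_eq_left',
              false_or, Classical.not_imp] at hc
            obtain rfl : v = -u := by
              rcases Int.units_eq_one_or u with rfl | rfl <;>
                rcases Int.units_eq_one_or v with rfl | rfl <;> simp_all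
            exact ⟨[], u, L, T', rfl, hL ▸ hc.1⟩

/-- **Britton's lemma** for words. -/
lemma exists_pinch {Λ : Type*} (e : Λ → G ⊕ ℤˣ) (w : List Λ)
    (hw : (w.map fun x => hnnLetter φ (e x)).prod ∈ (of (φ := φ)).range) :
    (∃ L : List G, w.map e = L.map Sum.inl) ∨
    ∃ (p : List Λ) (x : Λ) (V : List Λ) (y : Λ) (q : List Λ) (u : ℤˣ) (L : List G), w = p ++ x :: (V ++ y :: q) ∧ e x = Sum.inr u ∧ e y = Sum.inr (-u) ∧
      V.map e = L.map Sum.inl ∧ L.prod ∈ toSubgroup A B u := by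
  rcases pinch_or_reduced φ (w.map e) with ⟨p, u, L, q, h, hL⟩ | ⟨R, L, T, hR, h, -, hT⟩
  · right
    obtain ⟨p, w', rfl, -, h₁⟩ := List.map_eq_append_iff.1 h
    obtain ⟨x, w', rfl, hx, h₂⟩ := List.map_eq_cons_iff.1 h₁
    obtain ⟨V, w', rfl, hV, h₃⟩ := List.map_eq_append_iff.1 h₂
    obtain ⟨y, q, rfl, hy, -⟩ := List.map_eq_cons_iff.1 h₃
    exact ⟨p, x, V, y, q, u, L, rfl, hx, hy, hV, hL⟩
  · left
    rw [← Function.comp_def, ← List.map_map, ← hR] at hw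
    have := ReducedWord.toList_eq_nil_of_mem_of_range φ R hw
    rcases hT with ⟨-, rfl⟩ | ⟨u, g, T', l, h', -⟩
    · exact ⟨L, by simpa using h⟩
    · simp [this] at h'

end Britton

section Hopf

/-- A surjective endomorphism with `f g = 1` witnesses that `g` dies in every group that admits
only finitely many homomorphisms from `G`. -/
lemma map_eq_one_of_surjective {G H : Type*} [Group G] [Group H] [Finite (G →* H)] {f : G →* G}
    (hf : Function.Surjective f) {g : G} (hg : f g = 1) (φ : G →* H) : φ g = 1 := by
  have hinj : Function.Injective fun ψ : G →* H => ψ.comp f := fun ψ ψ' h =>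
    (MonoidHom.cancel_right hf).1 h
  obtain ⟨ψ, rfl⟩ := Finite.surjective_of_injective hinj φ
  simp [hg]

lemma finite_presentedGroup_hom {X H : Type*} [Finite X] [Group H] [Finite H]
    (R : Set (FreeGroup X)) : Finite (PresentedGroup R →* H) :=
  Finite.of_injective (fun φ x => φ (PresentedGroup.of x)) fun _ _ h =>
    PresentedGroup.ext fun x => congrFun h x

end Hopf

section CyclicHNN

variable {G : Type*} [Group G] {x y : G}

/-- The isomorphism between two infinite cyclic subgroups that matches their generators. -/
noncomputable def cyclicEquiv (hx : Function.Injective (zpowersHom G x))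
    (hy : Function.Injective (zpowersHom G y)) :
    (zpowersHom G x).range ≃* (zpowersHom G y).range :=
  (MonoidHom.ofInjective hx).symm.trans (MonoidHom.ofInjective hy)

lemma t_mul_of_cyclicEquiv (hx : Function.Injective (zpowersHom G x))
    (hy : Function.Injective (zpowersHom G y)) :
    HNNExtension.t * HNNExtension.of x =
      HNNExtension.of (φ := cyclicEquiv hx hy) y * HNNExtension.t := by
  have h {z : G} (hz : Function.Injective (zpowersHom G z)) :
      ((MonoidHom.ofInjective hz (Multiplicative.ofAdd 1) : (zpowersHom G z).range) : G) = z :=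
    zpow_one z
  have h' := HNNExtension.t_mul_of (φ := cyclicEquiv hx hy)
    (MonoidHom.ofInjective hx (Multiplicative.ofAdd 1))
  rw [cyclicEquiv, MulEquiv.trans_apply, MulEquiv.symm_apply_apply, h hx, h hy] at h'
  exact h'

lemma mem_range_zpowersHom {g : G} : g ∈ (zpowersHom G x).range ↔ ∃ k : ℤ, x ^ k = g := by
  simp [MonoidHom.mem_range, Multiplicative.exists]

end CyclicHNN

section Words

variable {β B S G H : Type*} [Group G] [Group H]

lemma letterEval_comp (f : G →* H) (gen : β → G) (x : β ⊕ β) :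
    letterEval (f ∘ gen) x = f (letterEval gen x) := by
  cases x <;> simp [letterEval]

lemma eval_comp (f : G →* H) (gen : β → G) (w : List (β ⊕ β)) :
    eval (f ∘ gen) w = f (eval gen w) := by
  induction w with
  | nil => simp
  | cons x w ih => simp [ih, letterEval_comp]

lemma letterEval_baseLetter (gen : B ⊕ S → G) (x : B ⊕ B) :
    letterEval gen (baseLetter x) = letterEval (gen ∘ Sum.inl) x := by
  cases x <;> rfl

lemma eval_baseWord (gen : B ⊕ S → G) (w : List (B ⊕ B)) :
    eval gen (baseWord w) = eval (gen ∘ Sum.inl) w := by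
  induction w with
  | nil => rfl
  | cons x w ih => simp [ih, letterEval_baseLetter]

lemma HasPinch.append {A : Type*} [CommGroup A] {gA : B → A}
    {strip : (B ⊕ S) ⊕ (B ⊕ S) → B ⊕ B → B ⊕ B → Prop} {w : List ((B ⊕ S) ⊕ (B ⊕ S))}
    (h : HasPinch gA strip w) (u v : List ((B ⊕ S) ⊕ (B ⊕ S))) :
    HasPinch gA strip (u ++ w ++ v) := by
  obtain ⟨p, σ, V, q, y, z, k, rfl, hs, hV⟩ := h
  exact ⟨u ++ p, σ, V, q ++ v, y, z, k, by simp, hs, hV⟩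

end Words

namespace Wise

/-- The edge generator conjugated to `d` by a stable letter. -/
def edge : Bool → Fin 3 := fun c => cond c 1 0

/-- The generators `a`, `b` and `d = a² b²` of the plane. -/
def plane : Fin 3 → Multiplicative ℤ × Multiplicative ℤ :=
  ![(Multiplicative.ofAdd 1, 1), (1, Multiplicative.ofAdd 1),
    (Multiplicative.ofAdd 2, Multiplicative.ofAdd 2)]

/-- The squares of the Cayley graph of Wise's group on the stable letters. -/
inductive Strip : (Fin 3 ⊕ Bool) ⊕ (Fin 3 ⊕ Bool) → Fin 3 ⊕ Fin 3 → Fin 3 ⊕ Fin 3 → Prop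
  | pos_inl (c : Bool) : Strip (.inl (.inr c)) (.inl (edge c)) (.inl 2)
  | pos_inr (c : Bool) : Strip (.inl (.inr c)) (.inr (edge c)) (.inr 2)
  | neg_inl (c : Bool) : Strip (.inr (.inr c)) (.inl 2) (.inl (edge c))
  | neg_inr (c : Bool) : Strip (.inr (.inr c)) (.inr 2) (.inr (edge c))

lemma Strip.swap {σ : (Fin 3 ⊕ Bool) ⊕ (Fin 3 ⊕ Bool)} {y z : Fin 3 ⊕ Fin 3}
    (h : Strip σ y z) : Strip σ y.swap z.swap := by
  cases h <;> constructor

lemma exists_strip_pos {g : Multiplicative ℤ × Multiplicative ℤ} (c : Bool)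
    (h : ∃ k : ℤ, plane (edge c) ^ k = g) :
    ∃ y z, ∃ k : ℕ, Strip (.inl (.inr c)) y z ∧ g = letterEval plane y ^ k := by
  obtain ⟨k, rfl⟩ := h
  obtain ⟨n, rfl | rfl⟩ := k.eq_nat_or_neg
  · exact ⟨_, _, n, .pos_inl c, by simp [letterEval]⟩
  · exact ⟨_, _, n, .pos_inr c, by simp [letterEval]⟩

lemma exists_strip_neg {g : Multiplicative ℤ × Multiplicative ℤ} (c : Bool)
    (h : ∃ k : ℤ, plane 2 ^ k = g) :
    ∃ y z, ∃ k : ℕ, Strip (.inr (.inr c)) y z ∧ g = letterEval plane y ^ k := by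
  obtain ⟨k, rfl⟩ := h
  obtain ⟨n, rfl | rfl⟩ := k.eq_nat_or_neg
  · exact ⟨_, _, n, .neg_inl c, by simp [letterEval]⟩
  · exact ⟨_, _, n, .neg_inr c, by simp [letterEval]⟩

lemma zpowersHom_plane_injective (i : Fin 3) :
    Function.Injective (zpowersHom _ (plane i)) := by
  rw [injective_iff_map_eq_one]
  intro k hk
  rw [zpowersHom_apply] at hk
  have h1 := congrArg (fun g => g.1.toAdd) hk
  have h2 := congrArg (fun g => g.2.toAdd) hk
  apply Multiplicative.toAdd.injective
  fin_cases i <;> simp [plane] at h1 h2 ⊢ <;> assumption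

/-- The linear functional with coefficients `m` and `n` on the plane. -/
def functional (m n : ℤ) : Multiplicative ℤ × Multiplicative ℤ →* Multiplicative ℤ :=
  (zpowGroupHom m).coprod (zpowGroupHom n)

lemma extremal (y : Fin 3 ⊕ Fin 3) :
    ∃ l : Multiplicative ℤ × Multiplicative ℤ →* Multiplicative ℤ,
      ∀ x, x ≠ y → l (letterEval plane x) < l (letterEval plane y) := by
  have key : ∀ i : Fin 3, ∃ m n : ℤ, ∀ x, x ≠ .inl i →
      functional m n (letterEval plane x) < functional m n (letterEval plane (.inl i)) ∧
      functional (-m) (-n) (letterEval plane x.swap) <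
        functional (-m) (-n) (letterEval plane (.inr i)) := by
    intro i
    refine ⟨![3, -2, 1] i, ![-2, 3, 1] i, ?_⟩
    fin_cases i <;> rintro (x | x) hx <;> fin_cases x <;>
      first
      | exact absurd rfl hx
      | decide
  cases y with
  | inl i =>
    obtain ⟨m, n, h⟩ := key i
    exact ⟨functional m n, fun x hx => (h x hx).1⟩
  | inr i =>
    obtain ⟨m, n, h⟩ := key i
    refine ⟨functional (-m) (-n), fun x hx => ?_⟩
    simpa using (h x.swap (by cases x <;> simp_all)).2


open HNNExtension

/-- The identification of `⟨a⟩` with `⟨d⟩`. -/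
noncomputable abbrev innerEquiv :=
  cyclicEquiv (zpowersHom_plane_injective 0) (zpowersHom_plane_injective 2)

/-- The HNN extension of the plane whose stable letter conjugates `a` to `d`. -/
abbrev InnerHNN : Type :=
  HNNExtension (Multiplicative ℤ × Multiplicative ℤ) _ _ innerEquiv

/-- The generators of `InnerHNN`; the second stable letter is sent to `1`. -/
noncomputable def innerGen : Fin 3 ⊕ Bool → InnerHNN :=
  Sum.elim (of ∘ plane) fun c => cond c 1 t

lemma zpowersHom_inner_injective (i : Fin 3) :
    Function.Injective (zpowersHom InnerHNN (of (plane i))) := by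
  have : zpowersHom InnerHNN (of (plane i)) = of.comp (zpowersHom _ (plane i)) := by
    ext
    simp
  rw [this]
  exact (of_injective _).comp (zpowersHom_plane_injective i)

/-- The identification of `⟨b⟩` with `⟨d⟩` in `InnerHNN`. -/
noncomputable abbrev outerEquiv :=
  cyclicEquiv (zpowersHom_inner_injective 1) (zpowersHom_inner_injective 2)

/-- The HNN extension of `InnerHNN` whose stable letter conjugates `b` to `d`. -/
abbrev OuterHNN : Type :=
  HNNExtension InnerHNN _ _ outerEquiv

/-- The generators of `OuterHNN`. -/
noncomputable def outerGen : Fin 3 ⊕ Bool → OuterHNN :=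
  Sum.elim (of ∘ of ∘ plane) fun c => cond c t (of t)

/-- A letter is either a stable letter of `InnerHNN` or an element of the plane. -/
def innerLetter : (Fin 3 ⊕ Bool) ⊕ (Fin 3 ⊕ Bool) → (Multiplicative ℤ × Multiplicative ℤ) ⊕ ℤˣ
  | .inl (.inl i) => .inl (plane i)
  | .inr (.inl i) => .inl (plane i)⁻¹
  | .inl (.inr c) => cond c (.inl 1) (.inr 1)
  | .inr (.inr c) => cond c (.inl 1) (.inr (-1))

/-- A letter is either a stable letter of `OuterHNN` or an element of `InnerHNN`. -/
noncomputable def outerLetter : (Fin 3 ⊕ Bool) ⊕ (Fin 3 ⊕ Bool) → InnerHNN ⊕ ℤˣ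
  | .inl (.inl i) => .inl (of (plane i))
  | .inr (.inl i) => .inl (of (plane i))⁻¹
  | .inl (.inr c) => cond c (.inr 1) (.inl t)
  | .inr (.inr c) => cond c (.inr (-1)) (.inl t⁻¹)

lemma hnnLetter_innerLetter (x : (Fin 3 ⊕ Bool) ⊕ (Fin 3 ⊕ Bool)) :
    hnnLetter innerEquiv (innerLetter x) = letterEval innerGen x := by
  rcases x with (i | (_ | _)) | (i | (_ | _)) <;>
    simp [innerLetter, innerGen, letterEval, hnnLetter]

lemma hnnLetter_outerLetter (x : (Fin 3 ⊕ Bool) ⊕ (Fin 3 ⊕ Bool)) :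
    hnnLetter outerEquiv (outerLetter x) = letterEval outerGen x := by
  rcases x with (i | (_ | _)) | (i | (_ | _)) <;>
    simp [outerLetter, outerGen, letterEval, hnnLetter]

/-- The stable letter of `OuterHNN` does not occur in the word. -/
def IsInnerWord (w : List ((Fin 3 ⊕ Bool) ⊕ (Fin 3 ⊕ Bool))) : Prop :=
  .inl (.inr true) ∉ w ∧ .inr (.inr true) ∉ w

lemma exists_baseWord {V : List ((Fin 3 ⊕ Bool) ⊕ (Fin 3 ⊕ Bool))} (hV : IsInnerWord V)
    {L : List (Multiplicative ℤ × Multiplicative ℤ)} (hL : V.map innerLetter = L.map Sum.inl) :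
    ∃ v, V = baseWord v ∧ L.prod = eval plane v := by
  induction V generalizing L with
  | nil =>
    obtain rfl : L = [] := by simpa using hL.symm
    exact ⟨[], rfl, rfl⟩
  | cons x V ih =>
    obtain ⟨g, L, rfl, hg, hL⟩ := List.map_eq_cons_iff.1 hL.symm
    obtain ⟨v, rfl, hv⟩ := ih ⟨fun h => hV.1 (.tail _ h), fun h => hV.2 (.tail _ h)⟩ hL.symm
    rcases x with (i | (_ | _)) | (i | (_ | _))
    · exact ⟨.inl i :: v, rfl, by simp_all [innerLetter, letterEval]⟩
    · simp [innerLetter] at hg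
    · exact absurd (.head _) hV.1
    · exact ⟨.inr i :: v, rfl, by simp_all [innerLetter, letterEval]⟩
    · simp [innerLetter] at hg
    · exact absurd (.head _) hV.2

lemma isInnerWord_and_eval {V : List ((Fin 3 ⊕ Bool) ⊕ (Fin 3 ⊕ Bool))}
    {L : List InnerHNN} (hL : V.map outerLetter = L.map Sum.inl) :
    IsInnerWord V ∧ L.prod = eval innerGen V := by
  induction V generalizing L with
  | nil =>
    obtain rfl : L = [] := by simpa using hL.symm
    exact ⟨⟨List.not_mem_nil, List.not_mem_nil⟩, rfl⟩
  | cons x V ih =>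
    obtain ⟨g, L, rfl, hg, hL⟩ := List.map_eq_cons_iff.1 hL.symm
    obtain ⟨⟨h1, h2⟩, hv⟩ := ih hL.symm
    rcases x with (i | (_ | _)) | (i | (_ | _)) <;>
      simp_all [IsInnerWord, outerLetter, innerGen, letterEval]

lemma inner_britton {V : List ((Fin 3 ⊕ Bool) ⊕ (Fin 3 ⊕ Bool))} (hV : IsInnerWord V)
    {g : Multiplicative ℤ × Multiplicative ℤ} (hg : eval innerGen V = of g) :
    (∃ v, V = baseWord v ∧ eval plane v = g) ∨ HasPinch plane Strip V := by
  rcases exists_pinch innerEquiv innerLetter V (by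
      simp only [hnnLetter_innerLetter]
      exact ⟨g, hg.symm⟩) with ⟨L, hL⟩ | ⟨p, x, W, y, q, u, L, rfl, hx, hy, hW, hL⟩
  · obtain ⟨v, rfl, -⟩ := exists_baseWord hV hL
    refine .inl ⟨v, rfl, of_injective innerEquiv ?_⟩
    rw [← hg, eval_baseWord, innerGen, Sum.elim_comp_inl, eval_comp]
  · right
    obtain ⟨v, rfl, hv⟩ := exists_baseWord (V := W)
      ⟨fun h => hV.1 (by simp [h]), fun h => hV.2 (by simp [h])⟩ hW
    rw [hv] at hL
    have hVx : x ≠ .inl (.inr true) ∧ x ≠ .inr (.inr true) :=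
      ⟨fun h => hV.1 (by simp [h]), fun h => hV.2 (by simp [h])⟩
    have hVy : y ≠ .inl (.inr true) ∧ y ≠ .inr (.inr true) :=
      ⟨fun h => hV.1 (by simp [h]), fun h => hV.2 (by simp [h])⟩
    have : y = x.swap ∧ ∃ z z', ∃ k : ℕ, Strip x z z' ∧ eval plane v = letterEval plane z ^ k := by
      rcases Int.units_eq_one_or u with rfl | rfl
      · obtain rfl : x = .inl (.inr false) := by
          rcases x with (i | (_ | _)) | (i | (_ | _)) <;> simp_all [innerLetter]
        obtain rfl : y = .inr (.inr false) := by
          rcases y with (i | (_ | _)) | (i | (_ | _)) <;> simp_all [innerLetter]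
        exact ⟨rfl, exists_strip_pos false (mem_range_zpowersHom.1 hL)⟩
      · obtain rfl : x = .inr (.inr false) := by
          rcases x with (i | (_ | _)) | (i | (_ | _)) <;> simp_all [innerLetter]
        obtain rfl : y = .inl (.inr false) := by
          rcases y with (i | (_ | _)) | (i | (_ | _)) <;> simp_all [innerLetter]
        exact ⟨rfl, exists_strip_neg false (mem_range_zpowersHom.1 hL)⟩
    obtain ⟨rfl, z, z', k, hs, hk⟩ := this
    exact ⟨p, x, v, q, z, z', k, by simp, hs, hk⟩

lemma outer_britton {w : List ((Fin 3 ⊕ Bool) ⊕ (Fin 3 ⊕ Bool))}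
    {g : Multiplicative ℤ × Multiplicative ℤ} (hg : eval outerGen w = of (of g)) :
    (∃ v, w = baseWord v) ∨ HasPinch plane Strip w := by
  have hw : (w.map fun x => hnnLetter outerEquiv (outerLetter x)).prod = of (of g) := by
    simp only [hnnLetter_outerLetter]
    exact hg
  rcases exists_pinch outerEquiv outerLetter w ⟨_, hw.symm⟩ with
    ⟨L, hL⟩ | ⟨p, x, V, y, q, u, L, rfl, hx, hy, hV, hL⟩
  · obtain ⟨hi, hev⟩ := isInnerWord_and_eval hL
    have hL' := prod_map_hnnLetter_inl outerEquiv L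
    rw [← hL, List.map_map] at hL'
    rcases inner_britton hi (hev.symm.trans (of_injective outerEquiv (hL'.symm.trans hw))) with ⟨v, hv, -⟩ | h
    · exact .inl ⟨v, hv⟩
    · exact .inr h
  · right
    obtain ⟨hi, hev⟩ := isInnerWord_and_eval hV
    rw [hev] at hL
    have : ∃ c : Bool, ∃ g, eval innerGen V = of g ∧
        (x = .inl (.inr c) ∧ y = .inr (.inr c) ∧ (∃ k : ℤ, plane (edge c) ^ k = g) ∨
        x = .inr (.inr c) ∧ y = .inl (.inr c) ∧ ∃ k : ℤ, plane 2 ^ k = g) := by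
      rcases Int.units_eq_one_or u with rfl | rfl
      · obtain ⟨k, hk⟩ := mem_range_zpowersHom.1 hL
        refine ⟨true, plane 1 ^ k, by rw [← hk, map_zpow], .inl ⟨?_, ?_, k, rfl⟩⟩
        · rcases x with (i | (_ | _)) | (i | (_ | _)) <;> simp_all [outerLetter]
        · rcases y with (i | (_ | _)) | (i | (_ | _)) <;> simp_all [outerLetter]
      · obtain ⟨k, hk⟩ := mem_range_zpowersHom.1 hL
        refine ⟨true, plane 2 ^ k, by rw [← hk, map_zpow], .inr ⟨?_, ?_, k, rfl⟩⟩
        · rcases x with (i | (_ | _)) | (i | (_ | _)) <;> simp_all [outerLetter]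
        · rcases y with (i | (_ | _)) | (i | (_ | _)) <;> simp_all [outerLetter]
    obtain ⟨c, g, hVg, h⟩ := this
    rcases inner_britton hi hVg with ⟨v, rfl, rfl⟩ | hp
    · rcases h with ⟨rfl, rfl, h⟩ | ⟨rfl, rfl, h⟩
      · obtain ⟨z, z', k, hs, hk⟩ := exists_strip_pos c h
        exact ⟨p, _, v, q, z, z', k, by simp, hs, hk⟩
      · obtain ⟨z, z', k, hs, hk⟩ := exists_strip_neg c h
        exact ⟨p, _, v, q, z, z', k, by simp, hs, hk⟩
    · simpa using hp.append (p ++ [x]) (y :: q)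


open HNNExtension

/-- The relators `[a, b]`, `d = a² b²`, `s a s⁻¹ = d` and `t b t⁻¹ = d` of Wise's group. -/
def relators : Set (FreeGroup (Fin 3 ⊕ Bool)) :=
  {FreeGroup.of (.inl 0) * FreeGroup.of (.inl 1) *
      (FreeGroup.of (.inl 1) * FreeGroup.of (.inl 0))⁻¹,
    FreeGroup.of (.inl 2) * (FreeGroup.of (.inl 0) ^ 2 * FreeGroup.of (.inl 1) ^ 2)⁻¹,
    FreeGroup.of (.inr false) * FreeGroup.of (.inl 0) *
      (FreeGroup.of (.inl 2) * FreeGroup.of (.inr false))⁻¹,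
    FreeGroup.of (.inr true) * FreeGroup.of (.inl 1) *
      (FreeGroup.of (.inl 2) * FreeGroup.of (.inr true))⁻¹}

lemma relators_finite : relators.Finite := by
  simp [relators]

/-- The generators of Wise's group. -/
def gen : Fin 3 ⊕ Bool → PresentedGroup relators := PresentedGroup.of

lemma gen_comm : gen (.inl 0) * gen (.inl 1) = gen (.inl 1) * gen (.inl 0) :=
  mul_inv_eq_one.1 <| PresentedGroup.one_of_mem (rels := relators) <| by simp [relators]

lemma gen_two : gen (.inl 2) = gen (.inl 0) ^ 2 * gen (.inl 1) ^ 2 :=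
  mul_inv_eq_one.1 <| PresentedGroup.one_of_mem (rels := relators) <| by simp [relators]

lemma gen_stable (c : Bool) :
    gen (.inr c) * gen (.inl (edge c)) = gen (.inl 2) * gen (.inr c) := by
  cases c <;>
  exact mul_inv_eq_one.1 <| PresentedGroup.one_of_mem (rels := relators) <| by
    simp [relators, edge]

lemma exists_hom {H : Type*} [Group H] (f : Fin 3 ⊕ Bool → H)
    (hab : f (.inl 0) * f (.inl 1) = f (.inl 1) * f (.inl 0))
    (hd : f (.inl 2) = f (.inl 0) ^ 2 * f (.inl 1) ^ 2)
    (hs : ∀ c, f (.inr c) * f (.inl (edge c)) = f (.inl 2) * f (.inr c)) :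
    ∃ F : PresentedGroup relators →* H, F ∘ gen = f := by
  refine ⟨PresentedGroup.toGroup (f := f) ?_, funext fun x => PresentedGroup.toGroup.of _⟩
  have h0 := hs false
  have h1 := hs true
  simp only [edge, cond_true, cond_false] at h0 h1
  rintro r (rfl | rfl | rfl | rfl) <;>
    simp only [map_mul, map_inv, map_pow, FreeGroup.lift_apply_of, mul_inv_eq_one] <;>
    assumption

lemma generates : Generates gen := by
  intro g
  induction g using PresentedGroup.induction_on with
  | _ z =>
    induction z using FreeGroup.induction_on with
    | C1 => exact ⟨[], by simp⟩
    | of x => exact ⟨[.inl x], by simp [letterEval]; rfl⟩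
    | inv_of x _ => exact ⟨[.inr x], by simp [letterEval]; rfl⟩
    | mul x y hx hy =>
      obtain ⟨u, hu⟩ := hx
      obtain ⟨v, hv⟩ := hy
      exact ⟨u ++ v, by rw [eval_append, hu, hv, map_mul]⟩

lemma exists_hom_outerHNN : ∃ F : PresentedGroup relators →* OuterHNN, F ∘ gen = outerGen := by
  refine exists_hom outerGen ?_ ?_ ?_
  · simp only [outerGen, Sum.elim_inl, Function.comp_apply, ← map_mul]
    rw [mul_comm]
  · simp only [outerGen, Sum.elim_inl, Function.comp_apply, ← map_mul, ← map_pow]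
    congr 2
  · rintro (_ | _)
    · simp only [outerGen, Sum.elim_inl, Sum.elim_inr, Function.comp_apply, ← map_mul, edge,
        cond_false]
      exact congrArg of (t_mul_of_cyclicEquiv _ _)
    · exact t_mul_of_cyclicEquiv _ _

lemma exists_hom_plane : ∃ j : Multiplicative ℤ × Multiplicative ℤ →* PresentedGroup relators,
    j ∘ plane = gen ∘ Sum.inl := by
  refine ⟨MonoidHom.noncommCoprod (zpowersHom _ (gen (.inl 0))) (zpowersHom _ (gen (.inl 1)))
    fun m n => ?_, ?_⟩
  · have : Commute (gen (.inl 0)) (gen (.inl 1)) := gen_comm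
    exact this.zpow_zpow _ _
  · funext i
    fin_cases i
    · change gen (.inl 0) ^ (1 : ℤ) * gen (.inl 1) ^ (0 : ℤ) = gen (.inl 0)
      simp
    · change gen (.inl 0) ^ (0 : ℤ) * gen (.inl 1) ^ (1 : ℤ) = gen (.inl 1)
      simp
    · simp [plane, gen_two]
      rfl

lemma isIsometricHNN : IsIsometricHNN gen plane Strip where
  generates := generates
  eval_eq_iff u v := by
    obtain ⟨F, hF⟩ := exists_hom_outerHNN
    obtain ⟨j, hj⟩ := exists_hom_plane
    refine ⟨fun h => ?_, fun h => ?_⟩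
    · have h := congrArg F h
      rw [← eval_comp, ← eval_comp, hF, eval_baseWord, eval_baseWord, outerGen,
        Sum.elim_comp_inl, eval_comp, eval_comp, eval_comp, eval_comp] at h
      exact of_injective _ (of_injective _ h)
    · rw [eval_baseWord, eval_baseWord, ← hj, eval_comp, eval_comp, h]
  strip_swap _ _ _ := Strip.swap
  letterEval_mul σ y z h := by
    cases h with
    | pos_inl c => exact gen_stable c
    | pos_inr c =>
      have h : SemiconjBy (gen (.inr c)) (gen (.inl (edge c))) (gen (.inl 2)) := gen_stable c
      exact h.inv_right
    | neg_inl c =>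
      have h : SemiconjBy (gen (.inr c)) (gen (.inl (edge c))) (gen (.inl 2)) := gen_stable c
      exact h.inv_symm_left
    | neg_inr c =>
      have h : SemiconjBy (gen (.inr c)) (gen (.inl (edge c))) (gen (.inl 2)) := gen_stable c
      exact h.inv_symm_left.inv_right
  britton w u h := by
    obtain ⟨F, hF⟩ := exists_hom_outerHNN
    refine outer_britton (g := eval plane u) ?_
    have h := congrArg F h
    rw [← eval_comp, ← eval_comp, hF, eval_baseWord] at h
    rw [h, outerGen, Sum.elim_comp_inl, eval_comp, eval_comp]
  extremal := extremal

lemma exists_surjective_hom : ∃ f : PresentedGroup relators →* PresentedGroup relators,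
    Function.Surjective f ∧ f ∘ gen = Sum.elim (fun i => gen (.inl i) ^ 2) (gen ∘ .inr) := by
  have hab : Commute (gen (.inl 0)) (gen (.inl 1)) := gen_comm
  obtain ⟨f, hf⟩ := exists_hom (Sum.elim (fun i => gen (.inl i) ^ 2) (gen ∘ .inr))
    (hab.pow_pow 2 2).eq (by
      simp only [Sum.elim_inl]
      rw [gen_two, ((hab.pow_pow 2 2)).mul_pow]) (fun c => by
      have h : SemiconjBy (gen (.inr c)) (gen (.inl (edge c))) (gen (.inl 2)) := gen_stable c
      exact (h.pow_right 2).eq)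
  refine ⟨f, ?_, hf⟩
  have hS : ∀ c, gen (.inr c) ∈ f.range := fun c => ⟨gen (.inr c), congrFun hf (.inr c)⟩
  have hsq : ∀ i, gen (.inl i) ^ 2 ∈ f.range := fun i => ⟨gen (.inl i), congrFun hf (.inl i)⟩
  have hd : gen (.inl 2) ∈ f.range := gen_two ▸ mul_mem (hsq 0) (hsq 1)
  have he : ∀ c, gen (.inl (edge c)) ∈ f.range := fun c => by
    have : gen (.inl (edge c)) = (gen (.inr c))⁻¹ * (gen (.inl 2) * gen (.inr c)) :=
      eq_inv_mul_of_mul_eq (gen_stable c)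
    rw [this]
    exact mul_mem (inv_mem (hS c)) (mul_mem hd (hS c))
  rw [← MonoidHom.range_eq_top, eq_top_iff, ← PresentedGroup.closure_range_of,
    Subgroup.closure_le]
  rintro _ ⟨i | c, rfl⟩
  · fin_cases i
    · exact he false
    · exact he true
    · exact hd
  · exact hS c

/-- The word `c⁻¹ x y c` for a stable letter `c` and base letters `x`, `y`. -/
def conjWord (c : Bool) (x y : Fin 3 ⊕ Fin 3) : List ((Fin 3 ⊕ Bool) ⊕ (Fin 3 ⊕ Bool)) :=
  [.inr (.inr c), baseLetter x, baseLetter y, .inl (.inr c)]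

/-- A word for the commutator of `s⁻¹ a b s` and `t⁻¹ a b t`. -/
def kernelWord : List ((Fin 3 ⊕ Bool) ⊕ (Fin 3 ⊕ Bool)) :=
  conjWord false (.inl 0) (.inl 1) ++ (conjWord true (.inl 0) (.inl 1) ++
    (conjWord false (.inr 1) (.inr 0) ++ conjWord true (.inr 1) (.inr 0)))

lemma map_kernelWord {f : PresentedGroup relators →* PresentedGroup relators}
    (hf : f ∘ gen = Sum.elim (fun i => gen (.inl i) ^ 2) (gen ∘ .inr)) :
    f (eval gen kernelWord) = 1 := by
  have hab : Commute (gen (.inl 0)) (gen (.inl 1)) := gen_comm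
  have h1 : ∀ c, f (eval gen (conjWord c (.inl 0) (.inl 1))) = gen (.inl (edge c)) := fun c => by
    rw [← eval_comp, hf]
    simp only [conjWord, eval_cons, eval_nil, letterEval, baseLetter, Sum.elim_inl, Sum.elim_inr,
      Sum.map_inl, Function.comp_apply, mul_one]
    rw [← mul_assoc (gen (.inl 0) ^ 2), ← gen_two, ← gen_stable, inv_mul_cancel_left]
  have h2 : ∀ c, f (eval gen (conjWord c (.inr 1) (.inr 0))) = (gen (.inl (edge c)))⁻¹ :=
      fun c => by
    rw [← h1 c, ← map_inv, ← eval_wordInv]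
    rfl
  simp only [kernelWord, eval_append, map_mul, h1, h2, edge, cond_true, cond_false]
  rw [← mul_assoc, hab.eq]
  group

lemma hasPinch_cons {B S A : Type*} [CommGroup A] {gA : B → A}
    {strip : (B ⊕ S) ⊕ (B ⊕ S) → B ⊕ B → B ⊕ B → Prop} {σ : (B ⊕ S) ⊕ (B ⊕ S)}
    {w : List ((B ⊕ S) ⊕ (B ⊕ S))} (h : HasPinch gA strip (σ :: w)) :
    (∃ V q y z, ∃ k : ℕ, w = baseWord V ++ σ.swap :: q ∧ strip σ y z ∧
      eval gA V = letterEval gA y ^ k) ∨ HasPinch gA strip w := by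
  obtain ⟨p, τ, V, q, y, z, k, hw, hs, hV⟩ := h
  cases p with
  | nil =>
    obtain ⟨rfl, rfl⟩ := List.cons.inj hw
    exact .inl ⟨V, q, y, z, k, by simp, hs, hV⟩
  | cons x p =>
    obtain ⟨rfl, rfl⟩ := List.cons.inj hw
    exact .inr ⟨p, τ, V, q, y, z, k, rfl, hs, hV⟩

lemma HasPinch.of_base_cons {x : Fin 3 ⊕ Fin 3} {w : List ((Fin 3 ⊕ Bool) ⊕ (Fin 3 ⊕ Bool))}
    (h : HasPinch plane Strip (baseLetter x :: w)) : HasPinch plane Strip w := by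
  obtain ⟨V, q, y, z, k, -, hs, -⟩ | h := hasPinch_cons h
  · rcases x with x | x <;> cases hs
  · exact h

lemma HasPinch.of_conjWord_append {c : Bool} {x y : Fin 3 ⊕ Fin 3}
    {w : List ((Fin 3 ⊕ Bool) ⊕ (Fin 3 ⊕ Bool))}
    (hxy : ∀ k : ℤ, eval plane [x, y] ≠ plane 2 ^ k)
    (hw : w.head? ≠ some (.inr (.inr c)) ∧ ∀ v, w.head? ≠ some (baseLetter v))
    (h : HasPinch plane Strip (conjWord c x y ++ w)) : HasPinch plane Strip w := by
  obtain ⟨V, q, y', z, k, hV, hs, he⟩ | h := hasPinch_cons h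
  · exfalso
    have : V = [x, y] := by
      have hinj : Function.Injective (baseLetter (B := Fin 3) (S := Bool)) :=
        Sum.inl_injective.sumMap Sum.inl_injective
      have hV : baseLetter x :: baseLetter y :: .inl (.inr c) :: w =
        baseWord V ++ .inl (.inr c) :: q := hV
      rcases V with _ | ⟨v₁, _ | ⟨v₂, _ | ⟨v₃, V⟩⟩⟩
      · rcases x <;> cases hV
      · have hV := (List.cons.inj hV).2
        rcases y <;> cases hV
      · obtain ⟨h₁, hV⟩ := List.cons.inj hV
        obtain ⟨h₂, -⟩ := List.cons.inj hV
        rw [hinj h₁, hinj h₂]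
      · have hV := (List.cons.inj (List.cons.inj hV).2).2
        rcases v₃ <;> cases hV
    subst this
    cases hs with
    | neg_inl c => exact hxy k (by rw [he]; simp [letterEval])
    | neg_inr c => exact hxy (-k) (by rw [he]; simp [letterEval])
  · obtain ⟨V, q, y', z, k, hV, -, -⟩ | h := hasPinch_cons (HasPinch.of_base_cons (HasPinch.of_base_cons h))
    · rcases V with _ | ⟨v, V⟩ <;> subst hV
      · exact absurd rfl hw.1
      · exact absurd rfl (hw.2 v)
    · exact h

lemma eval_plane_ne (k : ℤ) : eval plane [.inl 0, .inl 1] ≠ plane 2 ^ k ∧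
    eval plane [.inr 1, .inr 0] ≠ plane 2 ^ k := by
  constructor <;>
  · intro h
    have h := congrArg (fun p => p.1.toAdd) h
    simp [eval, letterEval, plane] at h
    omega

lemma eval_kernelWord_ne_one : eval gen kernelWord ≠ 1 := by
  intro h
  obtain ⟨v, hv⟩ | h := isIsometricHNN.britton kernelWord [] h
  · rcases v with _ | ⟨_ | _, v⟩ <;> cases hv
  · have h₁ := fun k => (eval_plane_ne k).1
    have h₂ := fun k => (eval_plane_ne k).2
    have h := HasPinch.of_conjWord_append h₁ (by simp [conjWord, baseLetter]) h
    have h := HasPinch.of_conjWord_append h₁ (by simp [conjWord, baseLetter]) h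
    have h := HasPinch.of_conjWord_append h₂ (by simp [conjWord, baseLetter]) h
    rw [← List.append_nil (conjWord _ _ _)] at h
    have h := HasPinch.of_conjWord_append h₂ (by simp) h
    obtain ⟨p, σ, V, q, y, z, k, hw, -⟩ := h
    simp at hw

end Wise

/-- There exists a finitely presented group `G` with a finite
(inverse-closed) generating set such that `(G, Y)` is almost convex and `G` is
non-Hopfian, hence not residually finite. -/
theorem exists_almostConvex_nonHopfian :
    ∃ (X : Type) (_ : Fintype X) (R : Set (FreeGroup X)) (_ : R.Finite)
      (gen : X → PresentedGroup R),
      Generates gen ∧ AlmostConvex gen ∧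
      (∃ f : PresentedGroup R →* PresentedGroup R,
          Function.Surjective f ∧ ¬ Function.Injective f) ∧
      ¬ (∀ g : PresentedGroup R, g ≠ 1 →
          ∃ (H : Type) (_ : Group H) (_ : Finite H) (φ : PresentedGroup R →* H),
            φ g ≠ 1) := by
  open Wise in
  obtain ⟨f, hf, hfg⟩ := exists_surjective_hom
  refine ⟨Fin 3 ⊕ Bool, inferInstance, relators, relators_finite, gen, generates,
    isIsometricHNN.almostConvex, ⟨f, hf, fun hinj => ?_⟩, fun h => ?_⟩
  · exact eval_kernelWord_ne_one (hinj ((map_kernelWord hfg).trans (map_one f).symm))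
  · obtain ⟨H, _, _, φ, hφ⟩ := h _ eval_kernelWord_ne_one
    have := finite_presentedGroup_hom (H := H) relators
    exact hφ (map_eq_one_of_surjective hf (map_kernelWord hfg) φ)

end ACPaper
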